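/- arXiv:1509.08956 — 3 statements merged into one kernel-verified Lean document; each statement's English description precedes it below -/
import Mathlib

section
/- Let V be a nonzero finite-dimensional F-vector space, and let x, y, z ∈ End(V) with y invertible satisfy q x y − q⁻¹ y x = (q − q⁻¹)·1, q y z − q⁻¹ z y = (q − q⁻¹)·1, q z x − q⁻¹ x z = (q − q⁻¹)·1. Set n_y = q(1 − z x)/(q − q⁻¹), n_z = q(1 − x y)/(q − q⁻¹), Λ = q x + q⁻¹ y + q z − q x y z, and assume n_z is nilpotent and x is invertible. Then exp_q(n_z)⁻¹ ∘ n_y ∘ exp_q(n_z) = Λ x/(q − q⁻¹) + n_y − ((q + q⁻¹)/(q − q⁻¹)) x² + x n_z x. -/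
namespace Lusztig

variable (F : Type*) [Field F] (q : F)



/-- The q-integer [n]_q = (qⁿ − q⁻ⁿ)/(q − q⁻¹). -/
noncomputable def qInt (n : ℤ) : F := (q ^ n - q ^ (-n)) / (q - q⁻¹)

/-- The q-factorial [n]!_q = [n]_q [n−1]_q ⋯ [1]_q, with [0]!_q = 1. -/
noncomputable def qFact (n : ℕ) : F := ∏ i ∈ Finset.range n, qInt F q ((i : ℤ) + 1)

/-- The q-exponential exp_q(φ) = Σ_{i≥0} q^{binom(i,2)} φ^i / [i]!_q of a nilpotent
endomorphism φ of a finite-dimensional space.  Since the nilpotency index of φ is at most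
`finrank F V`, the series may be truncated at `finrank F V + 1` terms. -/
noncomputable def expq {V : Type*} [AddCommGroup V] [Module F V] (φ : Module.End F V) :
    Module.End F V :=
  ∑ i ∈ Finset.range (Module.finrank F V + 1), (q ^ (i.choose 2) / qFact F q i) • φ ^ i

/-- The inverse of the q-exponential: exp_{q⁻¹}(−φ) = Σ_{i≥0} (−1)^i q^{−binom(i,2)} φ^i / [i]!_q. -/
noncomputable def expqInv {V : Type*} [AddCommGroup V] [Module F V] (φ : Module.End F V) :
    Module.End F V :=
  ∑ i ∈ Finset.range (Module.finrank F V + 1),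
    (((-1 : F) ^ i * (q ^ (i.choose 2))⁻¹) / qFact F q i) • φ ^ i

/-- The q-exponential for square matrices (truncated at n + 1 terms, which is enough
for nilpotent matrices). -/
noncomputable def expqM {n : ℕ} (φ : Matrix (Fin n) (Fin n) F) : Matrix (Fin n) (Fin n) F :=
  ∑ i ∈ Finset.range (n + 1), (q ^ (i.choose 2) / qFact F q i) • φ ^ i


section helpers

variable {F : Type*} [Field F] {A : Type*} [Ring A] [Algebra F A]

lemma aux_inv (p : F) (hp : ∀ k : ℕ, p ^ (k + 1) - 1 ≠ 0) (c d : ℕ → F)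
    (hc0 : c 0 = 1) (hd0 : d 0 = 1)
    (hc : ∀ i, c (i + 1) * (p ^ (i + 1) - 1) = p ^ i * (p - 1) * c i)
    (hd : ∀ i, d (i + 1) * (p ^ (i + 1) - 1) = -((p - 1) * d i)) :
    PowerSeries.mk d * PowerSeries.mk c = 1 := by
  have h1 : PowerSeries.mk c = (1 - PowerSeries.C (p - 1) * PowerSeries.X) *
      PowerSeries.rescale p (PowerSeries.mk c) := by
    ext k
    rw [sub_mul, one_mul, mul_assoc]
    cases k with
    | zero =>
      have := PowerSeries.coeff_rescale (PowerSeries.mk c) p 0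
      rw [pow_zero, one_mul, PowerSeries.coeff_mk, PowerSeries.coeff_zero_eq_constantCoeff_apply]
        at this
      simp [this]
    | succ k =>
      simp only [map_sub (PowerSeries.coeff (k + 1)), PowerSeries.coeff_C_mul, PowerSeries.coeff_succ_X_mul,
        PowerSeries.coeff_rescale, PowerSeries.coeff_mk]
      linear_combination -hc k
  have h2 : PowerSeries.rescale p (PowerSeries.mk d) =
      (1 - PowerSeries.C (p - 1) * PowerSeries.X) * PowerSeries.mk d := by
    ext k
    rw [sub_mul, one_mul, mul_assoc]
    cases k with
    | zero => simp
    | succ k =>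
      simp only [map_sub (PowerSeries.coeff (k + 1)), PowerSeries.coeff_C_mul, PowerSeries.coeff_succ_X_mul,
        PowerSeries.coeff_rescale, PowerSeries.coeff_mk]
      linear_combination hd k
  have h3 : PowerSeries.rescale p (PowerSeries.mk d * PowerSeries.mk c) =
      PowerSeries.mk d * PowerSeries.mk c := by
    rw [map_mul, h2]
    conv_rhs => rw [h1]
    ring
  ext k
  cases k with
  | zero => simp [hc0, hd0]
  | succ k =>
    have h4 := congrArg (PowerSeries.coeff (k + 1)) h3
    rw [PowerSeries.coeff_rescale] at h4
    have h5 : (p ^ (k + 1) - 1) *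
      PowerSeries.coeff (k + 1) (PowerSeries.mk d * PowerSeries.mk c) = 0 := by
      linear_combination h4
    rw [(mul_eq_zero.mp h5).resolve_left (hp k)]
    simp [PowerSeries.coeff_one]

lemma aux_ev (c d : ℕ → F) (h : PowerSeries.mk d * PowerSeries.mk c = 1) (n : A) (N : ℕ)
    (hn : n ^ N = 0) :
    (∑ i ∈ Finset.range (N + 1), d i • n ^ i) * (∑ i ∈ Finset.range (N + 1), c i • n ^ i) = 1 := by
  let T : (ℕ → F) → Polynomial F := fun e =>
    ∑ i ∈ Finset.range (N + 1), Polynomial.monomial i (e i)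
  have hT : ∀ e k, k < N + 1 → (T e).coeff k = e k := by
    intro e k hk
    simp only [T, Polynomial.finsetSum_coeff, Polynomial.coeff_monomial]
    rw [Finset.sum_ite_eq', if_pos (Finset.mem_range.mpr hk)]
  have key : ∀ e : ℕ → F, (∑ i ∈ Finset.range (N + 1), e i • n ^ i) =
      Polynomial.aeval n (T e) := by
    intro e
    simp only [T, map_sum, Polynomial.aeval_monomial, Algebra.smul_def]
  rw [key, key, ← map_mul]
  have hd : (Polynomial.X : Polynomial F) ^ N ∣ T d * T c - 1 := by
    rw [Polynomial.X_pow_dvd_iff]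
    intro k hk
    have h2 := congrArg (PowerSeries.coeff k) h
    have h3 : (PowerSeries.coeff k (1 : PowerSeries F)) = (1 : Polynomial F).coeff k := by
      simp [PowerSeries.coeff_one, Polynomial.coeff_one]
    rw [Polynomial.coeff_sub, sub_eq_zero, ← h3, ← h2, Polynomial.coeff_mul, PowerSeries.coeff_mul]
    refine Finset.sum_congr rfl fun ij hij => ?_
    have := Finset.HasAntidiagonal.mem_antidiagonal.mp hij
    rw [hT _ _ (by omega), hT _ _ (by omega), PowerSeries.coeff_mk, PowerSeries.coeff_mk]
  obtain ⟨Q, hQ⟩ := hd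
  have h6 := congrArg (Polynomial.aeval n) hQ
  rw [map_sub, map_mul (Polynomial.aeval n) (Polynomial.X ^ N), map_pow, Polynomial.aeval_X, hn,
    zero_mul, map_one, sub_eq_zero] at h6
  exact h6

lemma aux_pow (a : F) (x n : A) (h : x * n = a • (n * x)) (i : ℕ) :
    x * n ^ i = a ^ i • (n ^ i * x) := by
  induction i with
  | zero => simp
  | succ i ih =>
    rw [pow_succ, ← mul_assoc, ih, smul_mul_assoc, mul_assoc, h, mul_smul_comm, smul_smul,
      ← mul_assoc, ← pow_succ]

/-- x E = (1 - (1 - p⁻¹) n) E x -/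
lemma aux_x (p : F) (hp0 : p ≠ 0) (c : ℕ → F)
    (hc : ∀ i, c (i + 1) * (p ^ (i + 1) - 1) = p ^ i * (p - 1) * c i)
    (x n : A) (h : x * n = p⁻¹ • (n * x)) (N : ℕ) (hn : n ^ N = 0) :
    x * (∑ i ∈ Finset.range (N + 1), c i • n ^ i) =
      (∑ i ∈ Finset.range (N + 1), c i • n ^ i) * ((1 - (1 - p⁻¹) • n) * x) := by
  have e1 : x * (∑ i ∈ Finset.range (N + 1), c i • n ^ i) =
      (∑ i ∈ Finset.range (N + 1), (c i * p⁻¹ ^ i) • n ^ i) * x := by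
    rw [Finset.mul_sum, Finset.sum_mul]
    refine Finset.sum_congr rfl fun i _ => ?_
    rw [mul_smul_comm, aux_pow _ _ _ h, smul_smul, smul_mul_assoc]
  rw [e1, ← mul_assoc]
  congr 1
  rw [mul_sub, mul_one, eq_sub_iff_add_eq, ← eq_sub_iff_add_eq', ← Finset.sum_sub_distrib]
  rw [Finset.sum_range_succ, Finset.sum_range_succ', hn]
  simp only [smul_zero, add_zero, pow_zero, mul_one, sub_self]
  rw [Finset.sum_mul]
  refine Finset.sum_congr rfl fun i _ => ?_
  rw [← sub_smul, mul_smul_comm, smul_mul_assoc, ← pow_succ, smul_smul]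
  congr 1
  have hpi : p ^ i ≠ 0 := pow_ne_zero _ hp0
  have := hc i
  simp only [inv_pow, pow_succ] at *
  field_simp
  linear_combination -this

lemma aux_zpow (p : F) (hp0 : p ≠ 0) (hp1 : p - 1 ≠ 0) (x y z n : A)
    (hx : x * n = p⁻¹ • (n * x)) (hy : y * n = p • (n * y)) (hz : z * n = n * z + x - y) (i : ℕ) :
    z * n ^ (i + 1) = n ^ (i + 1) * z + ((p⁻¹ ^ i * (p ^ (i + 1) - 1)) / (p - 1)) • (n ^ i * x)
      - ((p ^ (i + 1) - 1) / (p - 1)) • (n ^ i * y) := by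
  induction i with
  | zero => simp [hz, hp1]
  | succ i ih =>
    rw [pow_succ n (i + 1), ← mul_assoc, ih, sub_mul, add_mul, mul_assoc, hz, smul_mul_assoc,
      smul_mul_assoc, mul_assoc (n ^ i), hx, mul_assoc (n ^ i), hy, mul_smul_comm, mul_smul_comm,
      mul_sub, mul_add, ← mul_assoc, ← mul_assoc, ← mul_assoc, ← pow_succ, ← pow_succ, smul_smul, smul_smul]
    have e1 : p⁻¹ ^ (i + 1) * (p ^ (i + 1 + 1) - 1) / (p - 1) =
        1 + p⁻¹ ^ i * (p ^ (i + 1) - 1) / (p - 1) * p⁻¹ := by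
      have hpi : p ^ i ≠ 0 := pow_ne_zero _ hp0
      simp only [inv_pow, pow_succ]
      field_simp
      ring
    have e2 : (p ^ (i + 1 + 1) - 1) / (p - 1) = 1 + (p ^ (i + 1) - 1) / (p - 1) * p := by
      field_simp
      ring
    rw [e1, e2]
    module

lemma aux_z (p : F) (hp0 : p ≠ 0) (hp1 : p - 1 ≠ 0) (c : ℕ → F)
    (hc : ∀ i, c (i + 1) * (p ^ (i + 1) - 1) = p ^ i * (p - 1) * c i)
    (x y z n : A)
    (hx : x * n = p⁻¹ • (n * x)) (hy : y * n = p • (n * y)) (hz : z * n = n * z + x - y)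
    (N : ℕ) (hn : n ^ N = 0) :
    z * (∑ i ∈ Finset.range (N + 1), c i • n ^ i) =
      (∑ i ∈ Finset.range (N + 1), c i • n ^ i) * (z + x)
      - y * (∑ i ∈ Finset.range (N + 1), c i • n ^ i) := by
  have e0 : ∀ e : ℕ → F, ∑ i ∈ Finset.range (N + 1), e i • n ^ i =
      ∑ i ∈ Finset.range N, e i • n ^ i := by
    intro e
    rw [Finset.sum_range_succ, hn, smul_zero, add_zero]
  have e1 : y * (∑ i ∈ Finset.range (N + 1), c i • n ^ i) =
      ∑ i ∈ Finset.range N, (c i * p ^ i) • (n ^ i * y) := by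
    rw [e0, Finset.mul_sum]
    refine Finset.sum_congr rfl fun i _ => ?_
    rw [mul_smul_comm, aux_pow _ _ _ hy, smul_smul]
  have e2 : (∑ i ∈ Finset.range (N + 1), c i • n ^ i) * x =
      ∑ i ∈ Finset.range N, c i • (n ^ i * x) := by
    rw [e0, Finset.sum_mul]
    simp only [smul_mul_assoc]
  have e3 : z * (∑ i ∈ Finset.range (N + 1), c i • n ^ i) -
      (∑ i ∈ Finset.range (N + 1), c i • n ^ i) * z =
      ∑ i ∈ Finset.range N, (c i • (n ^ i * x) - (c i * p ^ i) • (n ^ i * y)) := by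
    rw [Finset.sum_range_succ', mul_add, add_mul, Finset.mul_sum, Finset.sum_mul]
    simp only [pow_zero, mul_smul_comm, smul_mul_assoc, mul_one, one_mul]
    rw [add_sub_add_right_eq_sub, ← Finset.sum_sub_distrib]
    refine Finset.sum_congr rfl fun i _ => ?_
    rw [aux_zpow p hp0 hp1 x y z n hx hy hz i]
    have f2 : c i * p ^ i = c (i + 1) * ((p ^ (i + 1) - 1) / (p - 1)) := by
      rw [mul_div_assoc', hc]
      field_simp
    have f1 : c i = c (i + 1) * (p⁻¹ ^ i * (p ^ (i + 1) - 1) / (p - 1)) := by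
      rw [mul_div_assoc', mul_left_comm, hc, inv_pow]
      field_simp
    rw [f2]
    conv_rhs => rw [f1]
    module
  rw [mul_add, e1, e2, add_sub_assoc, ← Finset.sum_sub_distrib, ← e3]
  abel

end helpers

/-- exp_q(n_z)⁻¹ ∘ n_y ∘ exp_q(n_z)
= Λ x/(q − q⁻¹) + n_y − ((q + q⁻¹)/(q − q⁻¹)) x² + x n_z x. -/
theorem stmt15 (hq : q ≠ 0) (hroot : ∀ n : ℕ, 0 < n → q ^ n ≠ 1)
    (V : Type*) [AddCommGroup V] [Module F V] [FiniteDimensional F V] [Nontrivial V]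
    (x y z : Module.End F V) (hy : IsUnit y)
    (hxy : q • (x * y) - q⁻¹ • (y * x) = (q - q⁻¹) • (1 : Module.End F V))
    (hyz : q • (y * z) - q⁻¹ • (z * y) = (q - q⁻¹) • (1 : Module.End F V))
    (hzx : q • (z * x) - q⁻¹ • (x * z) = (q - q⁻¹) • (1 : Module.End F V))
    (ny nz Λ : Module.End F V)
    (hny : ny = (q / (q - q⁻¹)) • (1 - z * x))
    (hnz : nz = (q / (q - q⁻¹)) • (1 - x * y))
    (hΛ : Λ = q • x + q⁻¹ • y + q • z - q • (x * y * z))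
    (hnil : IsNilpotent nz) (hx : IsUnit x) :
    expqInv F q nz * ny * expq F q nz =
      (q - q⁻¹)⁻¹ • (Λ * x) + ny - ((q + q⁻¹) / (q - q⁻¹)) • (x ^ 2) + x * nz * x := by
  have hq2 : ∀ k : ℕ, (q ^ 2) ^ (k + 1) - 1 ≠ 0 := by
    intro k
    rw [← pow_mul, sub_ne_zero]
    exact hroot _ (by omega)
  have hp1 : q ^ 2 - 1 ≠ 0 := by simpa using hq2 0
  have hp0 : q ^ 2 ≠ 0 := pow_ne_zero _ hq
  have hr : q - q⁻¹ ≠ 0 := by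
    intro h
    apply hp1
    field_simp at h
    linear_combination h
  have hI : ∀ i : ℕ, qInt F q ((i : ℤ) + 1) = ((q ^ 2) ^ (i + 1) - 1) / (q ^ i * (q ^ 2 - 1)) := by
    intro i
    have e1 : q ^ ((i : ℤ) + 1) = q ^ (i + 1) := by exact_mod_cast zpow_natCast q (i + 1)
    have hqi : q ^ i ≠ 0 := pow_ne_zero _ hq
    rw [qInt, zpow_neg, e1, ← pow_mul, mul_comm 2, pow_mul, div_eq_div_iff hr (by positivity)]
    simp only [pow_succ]
    field_simp
  have hI0 : ∀ i : ℕ, qInt F q ((i : ℤ) + 1) ≠ 0 := by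
    intro i
    rw [hI]
    exact div_ne_zero (hq2 i) (mul_ne_zero (pow_ne_zero _ hq) hp1)
  have hF0 : ∀ i : ℕ, qFact F q i ≠ 0 := fun i => Finset.prod_ne_zero_iff.mpr fun j _ => hI0 j
  have hFs : ∀ i : ℕ, qFact F q (i + 1) = qFact F q i * qInt F q ((i : ℤ) + 1) := fun i =>
    Finset.prod_range_succ _ _
  have hCh : ∀ i : ℕ, (i + 1).choose 2 = i + i.choose 2 := by
    intro i
    rw [Nat.choose_succ_succ' i 1, Nat.choose_one_right]
  have hc : ∀ i : ℕ, (q ^ ((i + 1).choose 2) / qFact F q (i + 1)) * ((q ^ 2) ^ (i + 1) - 1) =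
      (q ^ 2) ^ i * (q ^ 2 - 1) * (q ^ (i.choose 2) / qFact F q i) := by
    intro i
    have h1 := hF0 i
    have h2 := hq2 i
    have hqi : q ^ i ≠ 0 := pow_ne_zero _ hq
    rw [hFs, hI, hCh, pow_add]
    generalize (q ^ 2) ^ (i + 1) - 1 = W at *
    field_simp
    ring
  have hd : ∀ i : ℕ, (((-1 : F) ^ (i + 1) * (q ^ ((i + 1).choose 2))⁻¹) / qFact F q (i + 1)) *
      ((q ^ 2) ^ (i + 1) - 1) =
      -((q ^ 2 - 1) * (((-1 : F) ^ i * (q ^ (i.choose 2))⁻¹) / qFact F q i)) := by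
    intro i
    have h1 := hF0 i
    have h2 := hq2 i
    have hqi : q ^ i ≠ 0 := pow_ne_zero _ hq
    have hqc : q ^ (i.choose 2) ≠ 0 := pow_ne_zero _ hq
    rw [hFs, hI, hCh, pow_add q, pow_succ (-1 : F)]
    generalize (q ^ 2) ^ (i + 1) - 1 = W at *
    field_simp
  have hN : nz ^ Module.finrank F V = 0 := by
    have := LinearMap.aeval_self_charpoly nz
    rwa [hnil.charpoly_eq_X_pow_finrank, map_pow, Polynomial.aeval_X] at this
  have hinv : expqInv F q nz * expq F q nz = 1 :=
    aux_ev _ _ (aux_inv (q ^ 2) hq2 (fun i => q ^ (i.choose 2) / qFact F q i)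
      (fun i => ((-1 : F) ^ i * (q ^ (i.choose 2))⁻¹) / qFact F q i)
      (by simp [qFact]) (by simp [qFact]) hc hd) nz _ hN
  have hyx : y * x = q ^ 2 • (x * y) - (q ^ 2 - 1) • (1 : Module.End F V) := by
    have := congrArg (fun t => q • t) hxy
    simp only [smul_sub, smul_smul, mul_inv_cancel₀ hq, one_smul] at this
    rw [sub_eq_iff_eq_add'] at this
    rw [eq_sub_iff_add_eq, ← sub_eq_zero]
    have e : q * (q - q⁻¹) = q ^ 2 - 1 := by field_simp
    rw [e] at this
    rw [pow_two, this]
    rw [← pow_two]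
    abel
  have hn' : (1 - (1 - (q ^ 2)⁻¹) • nz) = x * y := by
    rw [hnz, smul_smul]
    have e : (1 - (q ^ 2)⁻¹) * (q / (q - q⁻¹)) = 1 := by
      rw [mul_div_assoc', div_eq_one_iff_eq hr]
      field_simp
    rw [e, one_smul, sub_sub_cancel]
  have hxn : x * nz = (q ^ 2)⁻¹ • (nz * x) := by
    rw [hnz, mul_smul_comm, smul_mul_assoc, smul_comm]
    congr 1
    rw [sub_mul, mul_sub, mul_assoc, hyx, mul_sub, mul_smul_comm, mul_smul_comm, one_mul, mul_one]
    match_scalars <;> field_simp <;> ring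
  have hyn : y * nz = q ^ 2 • (nz * y) := by
    rw [hnz, mul_smul_comm, smul_mul_assoc, smul_comm]
    congr 1
    rw [sub_mul, mul_sub, ← mul_assoc, hyx, sub_mul, smul_mul_assoc, smul_mul_assoc, one_mul,
      mul_one]
    module
  have hcyc : x * y * z - z * x * y = ((q - q⁻¹) / q) • (x - y) := by
    have h1 := congrArg (fun t => t * y) hzx
    have h2 := congrArg (fun t => x * t) hyz
    simp only [sub_mul, mul_sub, smul_mul_assoc, mul_smul_comm, one_mul, mul_one, ← mul_assoc]
      at h1 h2
    have h3 : q • (x * y * z - z * x * y) = (q - q⁻¹) • (x - y) := by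
      rw [smul_sub (q - q⁻¹), ← h1, ← h2]
      module
    rw [div_eq_inv_mul, mul_smul, ← h3, smul_smul, inv_mul_cancel₀ hq, one_smul]
  have hzn : z * nz = nz * z + x - y := by
    have h1 : x - y = (q / (q - q⁻¹)) • (x * y * z - z * x * y) := by
      rw [hcyc, smul_smul, div_mul_div_cancel₀ hr, div_self hq, one_smul]
    rw [add_sub_assoc, h1, hnz, mul_smul_comm, smul_mul_assoc, mul_sub, sub_mul, ← mul_assoc,
      one_mul, mul_one]
    module
  obtain ⟨w, hwx⟩ := hx.exists_left_inv
  have hxE : x * expq F q nz = expq F q nz * (x * y * x) := by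
    have := aux_x (q ^ 2) hp0 (fun i => q ^ (i.choose 2) / qFact F q i) hc x nz hxn _ hN
    rw [hn'] at this
    exact this
  have hcomm : x * y * expq F q nz = expq F q nz * (x * y) := by
    have h1 : Commute nz (expq F q nz) :=
      Commute.sum_right _ _ _ fun i _ => (Commute.pow_right (Commute.refl nz) i).smul_right _
    have h2 : Commute (x * y) (expq F q nz) := by
      rw [← hn']
      exact (Commute.one_left _).sub_left (h1.smul_left _)
    exact h2
  have hxw : x * w = 1 := by
    obtain ⟨u, rfl⟩ := hx
    rw [Units.eq_inv_of_mul_eq_one_right hwx]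
    exact u.mul_inv
  have hyE : y * expq F q nz = expq F q nz * w := by
    calc y * expq F q nz = w * (x * y * expq F q nz) := by
            rw [← mul_assoc, ← mul_assoc, hwx, one_mul]
      _ = w * (expq F q nz * (x * y * x)) * w := by
            rw [hcomm, mul_assoc, mul_assoc, mul_assoc (x * y), hxw, mul_one]
      _ = expq F q nz * w := by
            rw [← hxE, ← mul_assoc, hwx, one_mul]
  have hzE : z * expq F q nz = expq F q nz * (z + x - w) := by
    have := aux_z (q ^ 2) hp0 hp1 (fun i => q ^ (i.choose 2) / qFact F q i) hc x y z nz hxn hyn hzn _ hN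
    rw [mul_sub, ← hyE]
    exact this
  have hzxE : z * x * expq F q nz = expq F q nz * ((z + x - w) * (x * y * x)) := by
    rw [mul_assoc, hxE, ← mul_assoc, hzE, mul_assoc]
  have hnyE : ny * expq F q nz =
      expq F q nz * ((q / (q - q⁻¹)) • (1 - (z + x - w) * (x * y * x))) := by
    rw [hny, smul_mul_assoc, sub_mul, hzxE, mul_smul_comm, mul_sub, one_mul, mul_one]
  rw [mul_assoc, hnyE, ← mul_assoc, hinv, one_mul]
  have e1 : (z + x - w) * (x * y * x) = z * x * y * x + x * x * y * x - y * x := by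
    have : w * (x * y * x) = y * x := by rw [← mul_assoc, ← mul_assoc, hwx, one_mul]
    rw [sub_mul, add_mul, this]
    simp only [mul_assoc]
  have e2 : z * x * y = x * y * z - ((q - q⁻¹) / q) • (x - y) := by
    rw [← hcyc, sub_sub_cancel]
  rw [e1, e2, hΛ, hny, hnz, pow_two]
  simp only [sub_mul, mul_sub, add_mul, mul_add, smul_mul_assoc, mul_smul_comm, one_mul, mul_one,
    smul_sub, smul_add, smul_smul, ← mul_assoc]
  have hr' : q ^ 2 - 1 ≠ 0 := hp1
  match_scalars <;> field_simp <;> ring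

end Lusztig
end

section
/- Let d ∈ ℕ and let x, y, z be the (d+1)×(d+1) matrices over F defined by: x has (i,i) entry q^{2i−d} for 0 ≤ i ≤ d and (i,i+1) entry q^{d} − q^{2i−d} for 0 ≤ i ≤ d−1, with all other entries 0; y is the diagonal matrix with (i,i) entry q^{d−2i}; z has (i,i) entry q^{2i−d} for 0 ≤ i ≤ d and (i,i−1) entry q^{−d} − q^{2i−d} for 1 ≤ i ≤ d, with all other entries 0. Let R be a rotator, i.e., an invertible matrix with R⁻¹ x R = y, R⁻¹ y R = z, R⁻¹ z R = x. Then a matrix R' is a rotator if and only if there exists a nonzero α ∈ F with R' = α R. -/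
namespace Lusztig

variable (F : Type*) [Field F] (q : F)

/-- The matrix representing x on the (d+1)-dimensional irreducible module:
(i,i) entry q^{2i−d}, (i,i+1) entry q^d − q^{2i−d}, all other entries 0. -/
noncomputable def mx (d : ℕ) : Matrix (Fin (d + 1)) (Fin (d + 1)) F :=
  Matrix.of fun i j =>
    if j = i then q ^ (2 * (i : ℤ) - d)
    else if (j : ℕ) = (i : ℕ) + 1 then q ^ (d : ℤ) - q ^ (2 * (i : ℤ) - d)
    else 0

/-- The matrix representing y: the diagonal matrix with (i,i) entry q^{d−2i}. -/
noncomputable def my (d : ℕ) : Matrix (Fin (d + 1)) (Fin (d + 1)) F :=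
  Matrix.diagonal fun i => q ^ ((d : ℤ) - 2 * (i : ℤ))

/-- The matrix representing z: (i,i) entry q^{2i−d}, (i,i−1) entry q^{−d} − q^{2i−d},
all other entries 0. -/
noncomputable def mz (d : ℕ) : Matrix (Fin (d + 1)) (Fin (d + 1)) F :=
  Matrix.of fun i j =>
    if j = i then q ^ (2 * (i : ℤ) - d)
    else if (i : ℕ) = (j : ℕ) + 1 then q ^ (-(d : ℤ)) - q ^ (2 * (i : ℤ) - d)
    else 0

theorem zpow_inj_aux {F : Type*} [Field F] {q : F} (hq : q ≠ 0)
    (hroot : ∀ n : ℕ, 0 < n → q ^ n ≠ 1) {a b : ℤ} (h : q ^ a = q ^ b) : a = b := by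
  have key : ∀ a b : ℤ, a < b → q ^ a ≠ q ^ b := by
    intro a b hab h
    apply hroot (b - a).toNat (by omega)
    rw [← zpow_natCast, Int.toNat_of_nonneg (by omega), zpow_sub₀ hq, h]
    exact div_self (zpow_ne_zero _ hq)
  rcases lt_trichotomy a b with h1 | h1 | h1
  · exact (key _ _ h1 h).elim
  · exact h1
  · exact (key _ _ h1 h.symm).elim

theorem comm_aux {F : Type*} [Field F] {n : ℕ} {R R' A B : Matrix (Fin n) (Fin n) F}
    (hR : IsUnit R) (hR' : IsUnit R') (h : R⁻¹ * A * R = B) (h' : R'⁻¹ * A * R' = B) :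
    (R' * R⁻¹) * A = A * (R' * R⁻¹) := by
  rw [Matrix.isUnit_iff_isUnit_det] at hR hR'
  have e1 : R⁻¹ * A = B * R⁻¹ := by
    rw [← h, Matrix.mul_nonsing_inv_cancel_right _ _ hR]
  have e2 : R' * B = A * R' := by
    rw [← h', Matrix.mul_assoc, Matrix.mul_nonsing_inv_cancel_left _ _ hR']
  rw [Matrix.mul_assoc, e1, ← Matrix.mul_assoc, e2, Matrix.mul_assoc]

theorem scalar_aux {F : Type*} [Field F] {q : F} (hq : q ≠ 0)
    (hroot : ∀ n : ℕ, 0 < n → q ^ n ≠ 1) (d : ℕ) (S : Matrix (Fin (d + 1)) (Fin (d + 1)) F)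
    (hx : S * mx F q d = mx F q d * S) (hy : S * my F q d = my F q d * S) :
    S = S 0 0 • (1 : Matrix (Fin (d + 1)) (Fin (d + 1)) F) := by
  have hoff : ∀ i j, i ≠ j → S i j = 0 := by
    intro i j hij
    have h := congrFun (congrFun hy i) j
    rw [my, Matrix.mul_diagonal, Matrix.diagonal_mul, mul_comm] at h
    by_contra h0
    have := zpow_inj_aux hq hroot (mul_right_cancel₀ h0 h)
    apply hij
    ext
    omega
  have hD : S = Matrix.diagonal fun i => S i i := by
    ext i j
    by_cases hij : i = j
    · subst hij; simp
    · rw [Matrix.diagonal_apply_ne _ hij, hoff i j hij]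
  have hstep : ∀ k : ℕ, ∀ hk : k < d + 1, S ⟨k, hk⟩ ⟨k, hk⟩ = S 0 0 := by
    intro k
    induction k with
    | zero => intro hk; rfl
    | succ k ih =>
      intro hk
      rw [← ih (by omega)]
      rw [hD] at hx
      have h := congrFun (congrFun hx ⟨k, by omega⟩) ⟨k + 1, hk⟩
      rw [Matrix.mul_diagonal, Matrix.diagonal_mul, mul_comm] at h
      refine (mul_left_cancel₀ ?_ h).symm
      simp only [mx, Matrix.of_apply, Fin.mk.injEq, Nat.succ_ne_self, if_false, if_true]
      intro h0
      have := zpow_inj_aux hq hroot (sub_eq_zero.mp h0)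
      omega
  ext i j
  by_cases hij : i = j
  · subst hij; simpa using hstep i i.2
  · simp [hoff i j hij, Matrix.one_apply_ne hij]

/-- if R is a rotator for the triple (x, y, z) of matrices of the
(d+1)-dimensional irreducible module, then R' is a rotator if and only if R' = α R for some
nonzero α ∈ F. -/
theorem stmt16 (hq : q ≠ 0) (hroot : ∀ n : ℕ, 0 < n → q ^ n ≠ 1) (d : ℕ)
    (R : Matrix (Fin (d + 1)) (Fin (d + 1)) F) (hR : IsUnit R)
    (hRx : R⁻¹ * mx F q d * R = my F q d)
    (hRy : R⁻¹ * my F q d * R = mz F q d)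
    (hRz : R⁻¹ * mz F q d * R = mx F q d)
    (R' : Matrix (Fin (d + 1)) (Fin (d + 1)) F) :
    (IsUnit R' ∧ R'⁻¹ * mx F q d * R' = my F q d ∧ R'⁻¹ * my F q d * R' = mz F q d ∧
      R'⁻¹ * mz F q d * R' = mx F q d) ↔
    ∃ α : F, α ≠ 0 ∧ R' = α • R := by
  constructor
  · rintro ⟨hR', h1, h2, h3⟩
    have hS := scalar_aux hq hroot d (R' * R⁻¹) (comm_aux hR hR' hRx h1) (comm_aux hR hR' hRy h2)
    set α := (R' * R⁻¹) 0 0 with hα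
    have hdet := (Matrix.isUnit_iff_isUnit_det _).mp hR
    have hE : R' = α • R := by
      rw [← Matrix.nonsing_inv_mul_cancel_right R R' hdet, hS, Matrix.smul_mul, Matrix.one_mul]
    refine ⟨α, ?_, hE⟩
    intro h0
    rw [h0, zero_smul] at hE
    rw [hE] at hR'
    exact not_isUnit_zero hR'
  · rintro ⟨α, hα, rfl⟩
    have hdet := (Matrix.isUnit_iff_isUnit_det _).mp hR
    have hinv : (α • R)⁻¹ = α⁻¹ • R⁻¹ := by
      apply Matrix.inv_eq_left_inv
      rw [Matrix.smul_mul, Matrix.mul_smul, smul_smul, inv_mul_cancel₀ hα, one_smul,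
        Matrix.nonsing_inv_mul _ hdet]
    have hc : ∀ A, (α • R)⁻¹ * A * (α • R) = R⁻¹ * A * R := by
      intro A
      rw [hinv, Matrix.smul_mul, Matrix.smul_mul, Matrix.mul_smul, smul_smul,
        inv_mul_cancel₀ hα, one_smul]
    refine ⟨?_, by rw [hc, hRx], by rw [hc, hRy], by rw [hc, hRz]⟩
    rw [Matrix.isUnit_iff_isUnit_det, Matrix.det_smul]
    exact ((isUnit_iff_ne_zero.mpr hα).pow _).mul hdet

end Lusztig
end

section
/- Let d ∈ ℕ and let x, y, z be the (d+1)×(d+1) matrices over F defined by: x has (i,i) entry q^{2i−d} for 0 ≤ i ≤ d and (i,i+1) entry q^{d} − q^{2i−d} for 0 ≤ i ≤ d−1, with all other entries 0; y is the diagonal matrix with (i,i) entry q^{d−2i}; z has (i,i) entry q^{2i−d} for 0 ≤ i ≤ d and (i,i−1) entry q^{−d} − q^{2i−d} for 1 ≤ i ≤ d, with all other entries 0. Set n_x = q(1 − y z)/(q − q⁻¹) and n_z = q(1 − x y)/(q − q⁻¹) (both nilpotent), and let Y be the diagonal matrix with (i,i) entry q^{2i(d−i)}. Then Ω := exp_q(n_x)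 · Y · exp_q(n_z) is invertible and satisfies Ω⁻¹ x Ω = y, Ω⁻¹ y Ω = z, Ω⁻¹ z Ω = x; that is, Ω is a rotator. -/
namespace Lusztig

variable (F : Type*) [Field F] (q : F)



section abs
variable {F} {A : Type*} [Ring A] [Algebra F A]

/-- Truncated exponential with coefficients c. -/
def tex (c : ℕ → F) (N : ℕ) (n : A) : A := ∑ i ∈ Finset.range N, c i • n ^ i

lemma tex_comm (c : ℕ → F) (N : ℕ) (n w : A) (h : n * w = w * n) :
    tex c N n * w = w * tex c N n := by
  have hc : ∀ i, n ^ i * w = w * n ^ i := fun i => ((show Commute n w from h).pow_left i).eq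
  simp only [tex, Finset.sum_mul, Finset.mul_sum, smul_mul_assoc, mul_smul_comm, hc]

lemma zpy (p : F) (y z n : A) (hz : z * n = p⁻¹ • (n * z))
    (hzy : z * y = 1 - (p⁻¹ * (1 - p)) • n) (i : ℕ) :
    z * n ^ i * y = (p⁻¹) ^ i • n ^ i - ((p⁻¹) ^ (i + 1) * (1 - p)) • n ^ (i + 1) := by
  have h1 : z * n ^ i = (p⁻¹) ^ i • (n ^ i * z) := by
    induction i with
    | zero => simp
    | succ i ih =>
      rw [pow_succ n, ← mul_assoc, ih, smul_mul_assoc, mul_assoc, hz, mul_smul_comm, smul_smul,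
        ← mul_assoc, pow_succ p⁻¹]
  rw [h1, smul_mul_assoc, mul_assoc, hzy, mul_sub, mul_one, mul_smul_comm, ← pow_succ, smul_sub,
    smul_smul]
  congr 2
  ring

lemma tex_zy (p : F) (hp : p ≠ 0) (c : ℕ → F)
    (hc : ∀ i, c (i + 1) * (1 - p ^ (i + 1)) = c i * (1 - p))
    (y z n : A) (hz : z * n = p⁻¹ • (n * z))
    (hzy : z * y = 1 - (p⁻¹ * (1 - p)) • n) (M : ℕ) :
    z * tex c M n * y = tex c M n - (c M * ((p⁻¹) ^ M - 1)) • n ^ M := by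
  induction M with
  | zero => simp [tex]
  | succ M ih =>
    have e : tex c (M + 1) n = tex c M n + c M • n ^ M := by simp [tex, Finset.sum_range_succ]
    rw [e, mul_add, add_mul, ih, mul_smul_comm, smul_mul_assoc, zpy p y z n hz hzy]
    have : c M * ((p⁻¹) ^ (M + 1) * (1 - p)) = c (M + 1) * ((p⁻¹) ^ (M + 1) - 1) := by
      have h2 : (p⁻¹) ^ (M + 1) * p ^ (M + 1) = 1 := by
        rw [← mul_pow, inv_mul_cancel₀ hp, one_pow]
      linear_combination (- (p⁻¹) ^ (M + 1)) * hc M - c (M + 1) * h2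
    rw [smul_sub, smul_smul (c M) (_ * _), this]
    module

lemma xcomm (p : F) (x y z n : A) (hz : n * z = p • (z * n)) (hy : y * n = p • (n * y))
    (hx : x * n = n * x + y - z) (i : ℕ) :
    x * n ^ (i + 1) = n ^ (i + 1) * x +
      (∑ a ∈ Finset.range (i + 1), p ^ a) • (n ^ i * y - z * n ^ i) := by
  have h1 : ∀ i : ℕ, n ^ i * z = p ^ i • (z * n ^ i) := by
    intro i
    induction i with
    | zero => simp
    | succ i ih =>
      rw [pow_succ n, mul_assoc, hz, mul_smul_comm, ← mul_assoc, ih, smul_mul_assoc, smul_smul,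
        mul_assoc, pow_succ' p]
  induction i with
  | zero => simp [hx]; abel
  | succ i ih =>
    rw [pow_succ n (i + 1), ← mul_assoc, ih, add_mul, mul_assoc _ x, hx, smul_mul_assoc,
      sub_mul, mul_assoc _ y, hy, mul_sub, mul_add, h1, mul_smul_comm, mul_assoc z, ← pow_succ,
      ← mul_assoc, ← pow_succ, ← mul_assoc, ← pow_succ]
    have e1 : (∑ a ∈ Finset.range (i + 1 + 1), p ^ a)
      = (∑ a ∈ Finset.range (i + 1), p ^ a) + p ^ (i + 1) := Finset.sum_range_succ _ _
    have e2 : (∑ a ∈ Finset.range (i + 1 + 1), p ^ a)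
      = p * (∑ a ∈ Finset.range (i + 1), p ^ a) + 1 := by
      rw [Finset.sum_range_succ', Finset.mul_sum]; simp [pow_succ']
    rw [smul_sub (∑ a ∈ Finset.range (i + 1 + 1), p ^ a)]
    nth_rewrite 1 [e2]
    rw [e1]
    module

lemma tex_x (p : F) (c : ℕ → F)
    (hc : ∀ i, c (i + 1) * (∑ a ∈ Finset.range (i + 1), p ^ a) = c i)
    (x y z n : A) (hz : n * z = p • (z * n)) (hy : y * n = p • (n * y))
    (hx : x * n = n * x + y - z) (M : ℕ) :
    x * tex c (M + 1) n = tex c (M + 1) n * x + tex c M n * y - z * tex c M n := by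
  induction M with
  | zero => simp [tex]
  | succ M ih =>
    have e : ∀ M, tex c (M + 1) n = tex c M n + c M • n ^ M := by
      simp [tex, Finset.sum_range_succ]
    rw [e (M + 1), mul_add, ih, mul_smul_comm, xcomm p x y z n hz hy hx, e M]
    rw [smul_add, smul_smul, hc]
    simp only [mul_add, add_mul, smul_mul_assoc, mul_smul_comm]
    module

/-- Everything about one exponential. -/
lemma one_exp (p : F) (hp : p ≠ 0) (hp1 : p ≠ 1) (c : ℕ → F)
    (hc : ∀ i, c (i + 1) * (∑ a ∈ Finset.range (i + 1), p ^ a) = c i)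
    (x y z n : A) (h1 : x * y = p • (y * x) + (1 - p) • 1)
    (h2 : y * z = p • (z * y) + (1 - p) • 1)
    (h3 : z * x = p • (x * z) + (1 - p) • 1)
    (hn : n = (1 - p)⁻¹ • (1 - y * z)) (M : ℕ) (hM : n ^ M = 0) :
    z * tex c (M + 1) n * y = tex c (M + 1) n ∧
    x * tex c (M + 1) n = tex c (M + 1) n * x + tex c (M + 1) n * y - z * tex c (M + 1) n ∧
    tex c (M + 1) n * (y * z) = (y * z) * tex c (M + 1) n := by
  have hp' : (1 - p) ≠ 0 := sub_ne_zero.mpr (Ne.symm hp1)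
  have h2' : z * y = p⁻¹ • (y * z) - (p⁻¹ * (1 - p)) • 1 := by
    rw [h2, smul_add, smul_smul, smul_smul, inv_mul_cancel₀ hp]; module
  have hyz : y * z = 1 - (1 - p) • n := by
    rw [hn, smul_smul, mul_inv_cancel₀ hp']; module
  have hzy : z * y = 1 - (p⁻¹ * (1 - p)) • n := by
    rw [h2', hyz, smul_sub, smul_smul]
    have h : p⁻¹ • (1 : A) - (p⁻¹ * (1 - p)) • (1 : A) = 1 := by
      rw [← sub_smul, show p⁻¹ - p⁻¹ * (1 - p) = 1 by field_simp; ring, one_smul]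
    rw [sub_right_comm, h]
  have hyn : y * n = p • (n * y) := by
    have e : y * (z * y) = (y * z) * y := (mul_assoc _ _ _).symm
    rw [hzy, hyz, mul_sub, sub_mul, mul_one, one_mul, mul_smul_comm, smul_mul_assoc] at e
    have e2 : (p⁻¹ * (1 - p)) • (y * n) = (1 - p) • (n * y) := sub_right_injective e
    have e3 := congrArg (fun t => (p * (1 - p)⁻¹) • t) e2
    simp only [smul_smul] at e3
    rw [show p * (1 - p)⁻¹ * (p⁻¹ * (1 - p)) = 1 by field_simp,
      show p * (1 - p)⁻¹ * (1 - p) = p by field_simp, one_smul] at e3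
    exact e3
  have hnz : n * z = p • (z * n) := by
    have e : (z * y) * z = z * (y * z) := (mul_assoc _ _ _)
    rw [hzy, hyz, mul_sub z, sub_mul _ _ z, mul_one, one_mul, mul_smul_comm, smul_mul_assoc] at e
    have e2 : (p⁻¹ * (1 - p)) • (n * z) = (1 - p) • (z * n) := sub_right_injective e
    have e3 := congrArg (fun t => (p * (1 - p)⁻¹) • t) e2
    simp only [smul_smul] at e3
    rw [show p * (1 - p)⁻¹ * (p⁻¹ * (1 - p)) = 1 by field_simp,
      show p * (1 - p)⁻¹ * (1 - p) = p by field_simp, one_smul] at e3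
    exact e3
  have hzn : z * n = p⁻¹ • (n * z) := by
    rw [hnz, smul_smul, inv_mul_cancel₀ hp, one_smul]
  have hx : x * n = n * x + y - z := by
    have e : x * (y * z) = (y * z) * x + (1 - p) • (z - y) := by
      rw [mul_assoc y z x, h3, ← mul_assoc, h1]
      simp only [mul_add, add_mul, smul_mul_assoc, mul_smul_comm, mul_one, one_mul, mul_assoc]
      module
    rw [hn, mul_smul_comm, mul_sub, e, smul_mul_assoc, sub_mul, mul_one, one_mul]
    have : y - z = (1 - p)⁻¹ • ((1 - p) • (y - z)) := by
      rw [smul_smul, inv_mul_cancel₀ hp', one_smul]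
    rw [add_sub_assoc, this]
    module
  have hc' : ∀ i, c (i + 1) * (1 - p ^ (i + 1)) = c i * (1 - p) := by
    intro i
    have := geom_sum_mul p (i + 1)
    rw [← hc i]
    linear_combination c (i + 1) * this
  have eM : tex c (M + 1) n = tex c M n := by simp [tex, Finset.sum_range_succ, hM]
  refine ⟨?_, ?_, ?_⟩
  · rw [tex_zy p hp c hc' y z n hzn hzy, pow_succ n, hM]; simp
  · have := tex_x p c hc x y z n hnz hyn hx M
    rw [← eM] at this
    exact this
  · apply tex_comm
    rw [hyz]; simp [mul_sub, sub_mul]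

lemma rot (x y yi z Y E G : A) (hy : y * yi = 1)
    (hYy : Y * y = y * Y) (hU : (x - yi) * Y = Y * (y * (x - yi) * y))
    (hL : Y * (z - yi) = y * (z - yi) * y * Y) (hyi : yi * y = 1)
    (E1 : z * E * y = E) (E2 : x * E = E * x + E * y - z * E)
    (E3 : E * (y * z) = (y * z) * E)
    (G1 : y * G * x = G) (G2 : z * G = G * z + G * x - y * G)
    (G3 : G * (x * y) = (x * y) * G) :
    x * (E * Y * G) = E * Y * G * y ∧ y * (E * Y * G) = E * Y * G * z ∧
    z * (E * Y * G) = E * Y * G * x := by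
  have zE : z * E = E * yi := by
    calc z * E = z * E * (y * yi) := by rw [hy, mul_one]
      _ = z * E * y * yi := by noncomm_ring
      _ = E * yi := by rw [E1]
  have yE : y * E = E * (y * z * y) := by
    calc y * E = y * (z * E * y) := by rw [E1]
      _ = (y * z * E) * y := by noncomm_ring
      _ = E * (y * z * y) := by rw [← E3]; noncomm_ring
  have hU' : (x - yi) * Y = Y * (y * x * y) - Y * y := by
    rw [hU, mul_sub, hy, sub_mul, one_mul, mul_sub]
  have hL' : Y * z = Y * yi + y * z * y * Y - y * Y := by
    rw [mul_sub, mul_sub y, hy, sub_mul, one_mul, sub_mul] at hL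
    rw [sub_eq_iff_eq_add] at hL
    rw [hL]; abel
  have hYyi : Y * yi = yi * Y := by
    calc Y * yi = yi * y * Y * yi := by rw [hyi, one_mul]
      _ = yi * (y * Y) * yi := by noncomm_ring
      _ = yi * Y * (y * yi) := by rw [← hYy]; noncomm_ring
      _ = yi * Y := by rw [hy, mul_one]
  have c3 : z * (E * Y * G) = E * Y * G * x := by
    calc z * (E * Y * G) = z * (E * Y * (y * G * x)) := by rw [G1]
      _ = z * E * (Y * y) * G * x := by noncomm_ring
      _ = (z * E * y) * Y * G * x := by rw [hYy]; noncomm_ring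
      _ = E * Y * G * x := by rw [E1]
  refine ⟨?_, ?_, c3⟩
  · calc x * (E * Y * G) = (x * E) * Y * G := by noncomm_ring
      _ = E * ((x - yi) * Y + y * Y) * G := by rw [E2, zE]; noncomm_ring
      _ = E * Y * y * ((x * y) * G) := by rw [hU', ← hYy]; noncomm_ring
      _ = E * Y * (y * G * x) * y := by rw [← G3]; noncomm_ring
      _ = E * Y * G * y := by rw [G1]
  · have Gz : G * z = z * G + y * G - G * x := by rw [G2]; abel
    calc y * (E * Y * G) = (y * E) * Y * G + z * E * Y * G - z * (E * Y * G) := by noncomm_ring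
      _ = E * (y * z * y * Y + yi * Y) * G - E * Y * G * x := by rw [c3, yE, zE]; noncomm_ring
      _ = E * (Y * z + Y * y) * G - E * Y * G * x := by rw [hL', hYyi, hYy]; congr 3; abel
      _ = E * Y * (z * G + y * G - G * x) := by noncomm_ring
      _ = E * Y * G * z := by rw [← Gz]; noncomm_ring

lemma tex_unit (c : ℕ → F) (h0 : c 0 = 1) (M : ℕ) (n : A) (hn : IsNilpotent n) :
    IsUnit (tex c (M + 1) n) := by
  have : tex c (M + 1) n = 1 + n * tex (fun i => c (i + 1)) M n := by
    simp [tex, Finset.sum_range_succ', h0, Finset.mul_sum, pow_succ', add_comm]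
  rw [this]
  apply IsNilpotent.isUnit_one_add
  exact Commute.isNilpotent_mul_right (tex_comm _ _ _ _ rfl).symm hn

end abs

section mat
variable {F}

lemma tri_pow {m : ℕ} (A : Matrix (Fin m) (Fin m) F)
    (h : ∀ i j : Fin m, ¬ (j < i) → A i j = 0) : A ^ m = 0 := by
  have key : ∀ k : ℕ, ∀ i j : Fin m, (i : ℕ) < j + k → (A ^ k) i j = 0 := by
    intro k
    induction k with
    | zero =>
      intro i j hij
      rw [pow_zero, Matrix.one_apply_ne]
      rintro rfl; omega
    | succ k ih =>
      intro i j hij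
      rw [pow_succ, Matrix.mul_apply]
      apply Finset.sum_eq_zero
      intro l _
      by_cases hl : j < l
      · rw [ih i l (by have : (j : ℕ) < l := hl; omega), zero_mul]
      · rw [h l j hl, mul_zero]
  ext i j
  exact key m i j (by omega)

lemma tri_pow' {m : ℕ} (A : Matrix (Fin m) (Fin m) F)
    (h : ∀ i j : Fin m, ¬ (i < j) → A i j = 0) : A ^ m = 0 := by
  have := tri_pow A.transpose (fun i j hij => h j i hij)
  rw [← Matrix.transpose_pow] at this
  simpa using congrArg Matrix.transpose this


lemma e1 (hq : q ≠ 0) (i d : ℕ) : q ^ (2 * (i : ℤ) - d) = (q ^ i) ^ 2 / q ^ d := by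
  rw [zpow_sub₀ hq, mul_comm, zpow_mul, zpow_natCast, zpow_natCast]; norm_cast

lemma e2 (hq : q ≠ 0) (i d : ℕ) : q ^ ((d : ℤ) - 2 * (i : ℤ)) = q ^ d / (q ^ i) ^ 2 := by
  rw [zpow_sub₀ hq, mul_comm, zpow_mul, zpow_natCast, zpow_natCast]; norm_cast

variable (F)

/-- Inverse of y. -/
noncomputable def myi (d : ℕ) : Matrix (Fin (d + 1)) (Fin (d + 1)) F :=
  Matrix.diagonal fun i => q ^ (2 * (i : ℤ) - d)

/-- Superdiagonal part of x. -/
noncomputable def mU (d : ℕ) : Matrix (Fin (d + 1)) (Fin (d + 1)) F :=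
  Matrix.of fun i j =>
    if (j : ℕ) = (i : ℕ) + 1 then q ^ (d : ℤ) - q ^ (2 * (i : ℤ) - d) else 0

/-- Subdiagonal part of z. -/
noncomputable def mL (d : ℕ) : Matrix (Fin (d + 1)) (Fin (d + 1)) F :=
  Matrix.of fun i j =>
    if (i : ℕ) = (j : ℕ) + 1 then q ^ (-(d : ℤ)) - q ^ (2 * (i : ℤ) - d) else 0

lemma mx_eq (d : ℕ) : mx F q d = myi F q d + mU F q d := by
  ext i j
  by_cases h : j = i
  · subst h; simp [mx, myi, mU]
  · have h' : i ≠ j := fun e => h e.symm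
    simp [mx, myi, mU, h, h']

lemma mz_eq (d : ℕ) : mz F q d = myi F q d + mL F q d := by
  ext i j
  by_cases h : j = i
  · subst h; simp [mz, myi, mL]
  · have h' : i ≠ j := fun e => h e.symm
    simp [mz, myi, mL, h, h']

lemma my_myi (hq : q ≠ 0) (d : ℕ) : my F q d * myi F q d = 1 := by
  rw [my, myi, Matrix.diagonal_mul_diagonal, ← Matrix.diagonal_one]
  congr 1; ext i
  rw [← zpow_add₀ hq]; simp

lemma myi_my (hq : q ≠ 0) (d : ℕ) : myi F q d * my F q d = 1 := by
  rw [my, myi, Matrix.diagonal_mul_diagonal, ← Matrix.diagonal_one]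
  congr 1; ext i
  rw [← zpow_add₀ hq]; simp

/-- The parameter p. -/
noncomputable def pp : F := (q ^ 2)⁻¹

lemma Uy (hq : q ≠ 0) (d : ℕ) : mU F q d * my F q d = pp F q • (my F q d * mU F q d) := by
  ext i j
  rw [my, Matrix.mul_diagonal, Matrix.smul_apply, Matrix.diagonal_mul, smul_eq_mul, e2 q hq, e2 q hq]
  by_cases h : (j : ℕ) = i + 1
  · simp only [mU, Matrix.of_apply, h, if_true, pp]; field_simp; ring
  · simp [mU, h]

lemma yL (hq : q ≠ 0) (d : ℕ) : my F q d * mL F q d = pp F q • (mL F q d * my F q d) := by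
  ext i j
  rw [my, Matrix.diagonal_mul, Matrix.smul_apply, Matrix.mul_diagonal, smul_eq_mul, e2 q hq, e2 q hq]
  by_cases h : (i : ℕ) = j + 1
  · simp only [mL, Matrix.of_apply, h, if_true, pp]; field_simp; ring
  · simp [mL, h]

lemma yiU (hq : q ≠ 0) (d : ℕ) : myi F q d * mU F q d = pp F q • (mU F q d * myi F q d) := by
  ext i j
  rw [myi, Matrix.diagonal_mul, Matrix.smul_apply, Matrix.mul_diagonal, smul_eq_mul, e1 q hq, e1 q hq]
  by_cases h : (j : ℕ) = i + 1
  · simp only [mU, Matrix.of_apply, h, if_true, pp]; field_simp; ring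
  · simp [mU, h]

lemma Lyi (hq : q ≠ 0) (d : ℕ) : mL F q d * myi F q d = pp F q • (myi F q d * mL F q d) := by
  ext i j
  rw [myi, Matrix.mul_diagonal, Matrix.smul_apply, Matrix.diagonal_mul, smul_eq_mul, e1 q hq, e1 q hq]
  by_cases h : (i : ℕ) = j + 1
  · simp only [mL, Matrix.of_apply, h, if_true, pp]; field_simp; ring
  · simp [mL, h]

lemma LU (hq : q ≠ 0) (d : ℕ) : mL F q d * mU F q d = Matrix.diagonal fun i : Fin (d + 1) =>
    ((q ^ d)⁻¹ - (q ^ (i : ℕ)) ^ 2 / q ^ d) * (q ^ d - (q ^ (i : ℕ)) ^ 2 / q ^ 2 / q ^ d) := by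
  ext i j
  rw [Matrix.mul_apply]
  induction i using Fin.cases with
  | zero =>
    rw [Finset.sum_eq_zero (fun k _ => by simp [mL])]
    by_cases h : j = 0
    · subst h; simp
    · have h' : 0 ≠ j := fun e => h e.symm
      simp [h']
  | succ i =>
    rw [Finset.sum_eq_single i.castSucc]
    · by_cases h : j = i.succ
      · subst h
        rw [Matrix.diagonal_apply_eq]
        simp only [mL, mU, Matrix.of_apply, e1 q hq, Fin.val_succ, Fin.val_castSucc, if_true,
          zpow_neg, zpow_natCast]
        field_simp
        ring
      · have h' : i.succ ≠ j := fun e => h e.symm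
        have h2 : ¬ ((j : ℕ) = i + 1) := fun e => h (Fin.ext (by simpa using e))
        simp [h', mU, h2]
    · intro k _ hk
      have h2 : ¬ ((i : ℕ) = k) := fun e => hk (Fin.ext (by simpa using e.symm))
      simp [mL, h2]
    · simp

lemma UL (hq : q ≠ 0) (d : ℕ) : mU F q d * mL F q d = Matrix.diagonal fun i : Fin (d + 1) =>
    (q ^ d - (q ^ (i : ℕ)) ^ 2 / q ^ d) * ((q ^ d)⁻¹ - (q ^ (i : ℕ)) ^ 2 * q ^ 2 / q ^ d) := by
  ext i j
  rw [Matrix.mul_apply]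
  induction i using Fin.lastCases with
  | last =>
    rw [Finset.sum_eq_zero (fun k _ => by
      have : ¬ ((k : ℕ) = d + 1) := by omega
      simp [mU, this])]
    by_cases h : j = Fin.last d
    · subst h
      rw [Matrix.diagonal_apply_eq]
      simp only [Fin.val_last]
      field_simp
      simp
    · have h' : Fin.last d ≠ j := fun e => h e.symm
      simp [h']
  | cast i =>
    rw [Finset.sum_eq_single i.succ]
    · by_cases h : j = i.castSucc
      · subst h
        rw [Matrix.diagonal_apply_eq]
        simp only [mL, mU, Matrix.of_apply, e1 q hq, Fin.val_succ, Fin.val_castSucc, if_true,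
          zpow_neg, zpow_natCast]
        field_simp
        ring
      · have h' : i.castSucc ≠ j := fun e => h e.symm
        have h2 : ¬ ((i : ℕ) = j) := fun e => h (Fin.ext (by simpa using e.symm))
        simp [h', mL, h2]
    · intro k _ hk
      have h2 : ¬ ((k : ℕ) = i + 1) := fun e => hk (Fin.ext (by simpa using e))
      simp [mU, h2]
    · simp

lemma R1 (hq : q ≠ 0) (d : ℕ) :
    mx F q d * my F q d = pp F q • (my F q d * mx F q d) + (1 - pp F q) • 1 := by
  rw [mx_eq, add_mul, mul_add, Uy F q hq, my_myi F q hq, myi_my F q hq]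
  module

lemma R2 (hq : q ≠ 0) (d : ℕ) :
    my F q d * mz F q d = pp F q • (mz F q d * my F q d) + (1 - pp F q) • 1 := by
  rw [mz_eq, add_mul, mul_add, yL F q hq, my_myi F q hq, myi_my F q hq]
  module

lemma R3 (hq : q ≠ 0) (d : ℕ) :
    mz F q d * mx F q d = pp F q • (mx F q d * mz F q d) + (1 - pp F q) • 1 := by
  have key : myi F q d * myi F q d + mL F q d * mU F q d =
      pp F q • (myi F q d * myi F q d + mU F q d * mL F q d) + (1 - pp F q) • 1 := by
    rw [LU F q hq, UL F q hq, myi, Matrix.diagonal_mul_diagonal]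
    ext i j
    by_cases h : i = j
    · subst h
      simp only [Matrix.add_apply, Matrix.smul_apply, Matrix.diagonal_apply_eq, Matrix.one_apply_eq,
        smul_eq_mul, e1 q hq, pp]
      field_simp
      ring
    · simp [h]
  rw [mx_eq, mz_eq, add_mul, mul_add, mul_add, add_mul, mul_add, mul_add, yiU F q hq, Lyi F q hq]
  calc _ = (myi F q d * myi F q d + mL F q d * mU F q d) + pp F q • (mU F q d * myi F q d) +
        pp F q • (myi F q d * mL F q d) := by abel
    _ = _ := by rw [key]; module

lemma qstep (hq : q ≠ 0) (d i : ℕ) (h : i + 1 ≤ d) :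
    q ^ (2 * (i + 1) * (d - (i + 1))) =
      q ^ (2 * i * (d - i)) * ((q ^ d / (q ^ i) ^ 2) * (q ^ d / (q ^ (i + 1)) ^ 2)) := by
  obtain ⟨k, rfl⟩ := Nat.exists_eq_add_of_le h
  rw [show i + 1 + k - (i + 1) = k by omega, show i + 1 + k - i = k + 1 by omega]
  field_simp
  ring

/-- The diagonal matrix Y. -/
def mY (d : ℕ) : Matrix (Fin (d + 1)) (Fin (d + 1)) F :=
  Matrix.diagonal fun i : Fin (d + 1) => q ^ (2 * (i : ℕ) * (d - (i : ℕ)))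

lemma UY (hq : q ≠ 0) (d : ℕ) :
    mU F q d * mY F q d = mY F q d * (my F q d * mU F q d * my F q d) := by
  ext i j
  rw [mY, my, Matrix.mul_diagonal, Matrix.diagonal_mul, Matrix.mul_diagonal, Matrix.diagonal_mul]
  by_cases h : (j : ℕ) = i + 1
  · rw [e2 q hq, e2 q hq, h, qstep F q hq d i (by omega)]; ring
  · simp [mU, h]

lemma YL (hq : q ≠ 0) (d : ℕ) :
    mY F q d * mL F q d = my F q d * mL F q d * my F q d * mY F q d := by
  ext i j
  rw [mY, my, Matrix.mul_diagonal, Matrix.diagonal_mul, Matrix.mul_diagonal, Matrix.diagonal_mul]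
  by_cases h : (i : ℕ) = j + 1
  · rw [e2 q hq, e2 q hq, h, qstep F q hq d j (by omega)]; ring
  · simp [mL, h]

/-- Coefficients of the q-exponential. -/
noncomputable def cc (i : ℕ) : F := q ^ (i.choose 2) / qFact F q i

lemma pp_ne (hroot : ∀ n : ℕ, 0 < n → q ^ n ≠ 1) : pp F q ≠ 1 := by
  intro h
  exact hroot 2 (by norm_num) (by simpa [pp] using h)

lemma qq_ne (hq : q ≠ 0) (hroot : ∀ n : ℕ, 0 < n → q ^ n ≠ 1) : q - q⁻¹ ≠ 0 := by
  intro h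
  apply hroot 2 (by norm_num)
  field_simp at h
  linear_combination h

lemma qInt_eq (hq : q ≠ 0) (hroot : ∀ n : ℕ, 0 < n → q ^ n ≠ 1) (i : ℕ) :
    qInt F q ((i : ℤ) + 1) = q ^ i * ∑ a ∈ Finset.range (i + 1), pp F q ^ a := by
  have h1 := qq_ne F q hq hroot
  have h2 : pp F q - 1 ≠ 0 := sub_ne_zero.mpr (pp_ne F q hroot)
  have h3 := geom_sum_mul (pp F q) (i + 1)
  rw [qInt, div_eq_iff h1]
  apply mul_right_cancel₀ h2
  rw [show ((i : ℤ) + 1) = ((i + 1 : ℕ) : ℤ) by push_cast; rfl, zpow_neg, zpow_natCast]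
  calc _ = q ^ i * (q - q⁻¹) * (pp F q ^ (i + 1) - 1) := by
        rw [pp, inv_pow]; field_simp; ring
    _ = _ := by rw [← h3]; ring

lemma qInt_ne (hq : q ≠ 0) (hroot : ∀ n : ℕ, 0 < n → q ^ n ≠ 1) (i : ℕ) :
    qInt F q ((i : ℤ) + 1) ≠ 0 := by
  rw [qInt]
  refine div_ne_zero ?_ (qq_ne F q hq hroot)
  rw [show ((i : ℤ) + 1) = ((i + 1 : ℕ) : ℤ) by push_cast; rfl, zpow_neg, zpow_natCast]
  intro h
  have h0 : q ^ (i + 1) ≠ 0 := pow_ne_zero _ hq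
  apply hroot (2 * (i + 1)) (by omega)
  rw [sub_eq_zero] at h
  rw [two_mul, pow_add]
  nth_rewrite 1 [h]
  exact inv_mul_cancel₀ h0

lemma cc_step (hq : q ≠ 0) (hroot : ∀ n : ℕ, 0 < n → q ^ n ≠ 1) (i : ℕ) :
    cc F q (i + 1) * (∑ a ∈ Finset.range (i + 1), pp F q ^ a) = cc F q i := by
  have h1 : qFact F q (i + 1) = qFact F q i * qInt F q ((i : ℤ) + 1) :=
    Finset.prod_range_succ _ _
  have h0 : qFact F q i ≠ 0 := Finset.prod_ne_zero_iff.mpr fun j _ => qInt_ne F q hq hroot j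
  have hs : (∑ a ∈ Finset.range (i + 1), pp F q ^ a) ≠ 0 := by
    intro h
    have := qInt_ne F q hq hroot i
    rw [qInt_eq F q hq hroot, h, mul_zero] at this
    exact this rfl
  rw [cc, cc, h1, qInt_eq F q hq hroot, Nat.choose_succ_succ' i 1, Nat.choose_one_right, pow_add]
  field_simp

end mat

/-- Ω = exp_q(n_x) Y exp_q(n_z) is a rotator for the triple (x, y, z) of
matrices of the (d+1)-dimensional irreducible module (and n_x, n_z are nilpotent). -/
theorem stmt17 (hq : q ≠ 0) (hroot : ∀ n : ℕ, 0 < n → q ^ n ≠ 1) (d : ℕ)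
    (nx nz Y Ω : Matrix (Fin (d + 1)) (Fin (d + 1)) F)
    (hnx : nx = (q / (q - q⁻¹)) • (1 - my F q d * mz F q d))
    (hnz : nz = (q / (q - q⁻¹)) • (1 - mx F q d * my F q d))
    (hY : Y = Matrix.diagonal fun i : Fin (d + 1) => q ^ (2 * (i : ℕ) * (d - (i : ℕ))))
    (hΩ : Ω = expqM F q nx * Y * expqM F q nz) :
    IsNilpotent nx ∧ IsNilpotent nz ∧
    IsUnit Ω ∧
    Ω⁻¹ * mx F q d * Ω = my F q d ∧
    Ω⁻¹ * my F q d * Ω = mz F q d ∧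
    Ω⁻¹ * mz F q d * Ω = mx F q d := by
  have hp0 : pp F q ≠ 0 := inv_ne_zero (pow_ne_zero _ hq)
  have hp1 := pp_ne F q hroot
  have hqq := qq_ne F q hq hroot
  have hcoef : q / (q - q⁻¹) = (1 - pp F q)⁻¹ := by
    have : (1 - pp F q) = (q - q⁻¹) / q := by rw [pp]; field_simp
    rw [this, inv_div]
  rw [hcoef] at hnx hnz
  have hx0 : nx ^ (d + 1) = 0 := by
    apply tri_pow
    intro i j hij
    rw [hnx, mz_eq, mul_add, my_myi F q hq, sub_add_cancel_left, Matrix.smul_apply,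
      Matrix.neg_apply, my, Matrix.diagonal_mul]
    have : ¬ ((i : ℕ) = j + 1) := fun e => hij (by rw [Fin.lt_def]; omega)
    simp [mL, this]
  have hz0 : nz ^ (d + 1) = 0 := by
    apply tri_pow'
    intro i j hij
    rw [hnz, mx_eq, add_mul, myi_my F q hq, sub_add_cancel_left, Matrix.smul_apply,
      Matrix.neg_apply, my, Matrix.mul_diagonal]
    have : ¬ ((j : ℕ) = i + 1) := fun e => hij (by rw [Fin.lt_def]; omega)
    simp [mU, this]
  have hc0 : cc F q 0 = 1 := by simp [cc, qFact]
  have hc := cc_step F q hq hroot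
  have r1 := R1 F q hq d
  have r2 := R2 F q hq d
  have r3 := R3 F q hq d
  have ex : expqM F q nx = tex (cc F q) (d + 1 + 1) nx := rfl
  have ez : expqM F q nz = tex (cc F q) (d + 1 + 1) nz := rfl
  obtain ⟨E1, E2, E3⟩ := one_exp (pp F q) hp0 hp1 (cc F q) hc _ _ _ nx r1 r2 r3 hnx (d + 1) hx0
  obtain ⟨G1, G2, G3⟩ := one_exp (pp F q) hp0 hp1 (cc F q) hc _ _ _ nz r3 r1 r2 hnz (d + 1) hz0
  have hY' : Y = mY F q d := hY
  have hU : mx F q d - myi F q d = mU F q d := by rw [mx_eq]; abel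
  have hL : mz F q d - myi F q d = mL F q d := by rw [mz_eq]; abel
  have hYu : IsUnit Y := by
    rw [hY, Matrix.isUnit_diagonal, Pi.isUnit_iff]
    intro i
    exact (pow_ne_zero _ hq).isUnit
  have hu : IsUnit Ω := by
    rw [hΩ, ex, ez]
    exact ((tex_unit _ hc0 _ _ ⟨_, hx0⟩).mul hYu).mul (tex_unit _ hc0 _ _ ⟨_, hz0⟩)
  obtain ⟨c1, c2, c3⟩ := rot (mx F q d) (my F q d) (myi F q d) (mz F q d) Y _ _
    (my_myi F q hq d) (by rw [hY, my, Matrix.diagonal_mul_diagonal, Matrix.diagonal_mul_diagonal]; simp only [mul_comm])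
    (by rw [hU, hY', UY F q hq]) (by rw [hL, hY', YL F q hq]) (myi_my F q hq d)
    E1 E2 E3 G1 G2 G3
  rw [← ex, ← ez, ← hΩ] at c1 c2 c3
  have hdet : IsUnit Ω.det := (Matrix.isUnit_iff_isUnit_det _).mp hu
  refine ⟨⟨_, hx0⟩, ⟨_, hz0⟩, hu, ?_, ?_, ?_⟩
  · rw [mul_assoc, c1, ← mul_assoc, Matrix.nonsing_inv_mul _ hdet, one_mul]
  · rw [mul_assoc, c2, ← mul_assoc, Matrix.nonsing_inv_mul _ hdet, one_mul]
  · rw [mul_assoc, c3, ← mul_assoc, Matrix.nonsing_inv_mul _ hdet, one_mul]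

end Lusztig
end
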